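/- With high probability, the following holds for the random double digraph G = G_{n,ᾱ}: for every vertex a and every stage m < height(a,G), if S_{G,a,m+1} is defined via ι = 2 (i.e., no R₁-edge but some R₂-edge leads from S_{G,a,m} to a vertex outside S_{G,a,0} ∪ ⋯ ∪ S_{G,a,m}), then |S_{G,a,m+1}| ≤ 2 · |S_{G,a,m}| · n^{α₂}. -/

import Mathlib

open MeasureTheory Finset

/-- The Bernoulli measure on `Bool` giving `true` probability `p` (for `p ∈ [0,1]`). -/
noncomputable def bern (p : ℝ) : Measure Bool :=
  ENNReal.ofReal p • Measure.dirac true + ENNReal.ofReal (1 - p) • Measure.dirac false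

instance (p : ℝ) : IsFiniteMeasure (bern p) := by
  constructor
  simp only [bern, Measure.add_apply, Measure.smul_apply, smul_eq_mul]
  exact ENNReal.add_lt_top.mpr
    ⟨ENNReal.mul_lt_top ENNReal.ofReal_lt_top (measure_lt_top _ _),
     ENNReal.mul_lt_top ENNReal.ofReal_lt_top (measure_lt_top _ _)⟩

/-- Sample space for the random double digraph `G_{n,ᾱ}`: for each ordered pair of
vertices, a coin for `R₁` and a coin for `R₂`. -/
abbrev Omega (n : ℕ) : Type := ((Fin n × Fin n) → Bool) × ((Fin n × Fin n) → Bool)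

/-- The law of `G_{n,ᾱ}`: all coins independent, the `R₁`-coin of each pair has success
probability `n^{-(1+α₁)}` and the `R₂`-coin has success probability `n^{-(1-α₂)}`. -/
noncomputable def digraphMeasure (α₁ α₂ : ℝ) (n : ℕ) : Measure (Omega n) :=
  (Measure.pi fun _ : Fin n × Fin n => bern ((n : ℝ) ^ (-(1 + α₁)))).prod
    (Measure.pi fun _ : Fin n × Fin n => bern ((n : ℝ) ^ (-(1 - α₂))))

/-- The (irreflexive) relation `R₁` of the sampled double digraph. -/
def Rone {n : ℕ} (ω : Omega n) (a b : Fin n) : Bool :=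
  if a = b then false else ω.1 (a, b)

/-- The (irreflexive) relation `R₂` of the sampled double digraph. -/
def Rtwo {n : ℕ} (ω : Omega n) (a b : Fin n) : Bool :=
  if a = b then false else ω.2 (a, b)

/-- `(levelAux R1 R2 a k).1 = S_{G,a,k}` and `(levelAux R1 R2 a k).2 = S_{G,a,0} ∪ ⋯ ∪ S_{G,a,k}`:
`S_0 = {a}`; given `S_0,…,S_k`, if some `R₁`-edge goes from `S_k` to a vertex outside
`S_0 ∪ ⋯ ∪ S_k` then `S_{k+1}` is the set of endpoints of such `R₁`-edges; otherwise, if some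
`R₂`-edge does, `S_{k+1}` is the set of endpoints of such `R₂`-edges; otherwise `S_{k+1} = ∅`
(the process has stopped). -/
def levelAux {n : ℕ} (R1 R2 : Fin n → Fin n → Bool) (a : Fin n) :
    ℕ → Finset (Fin n) × Finset (Fin n)
  | 0 => ({a}, {a})
  | k + 1 =>
    let p := levelAux R1 R2 a k
    let N1 := Finset.univ.filter fun b => b ∉ p.2 ∧ ∃ a' ∈ p.1, R1 a' b = true
    let N2 := Finset.univ.filter fun b => b ∉ p.2 ∧ ∃ a' ∈ p.1, R2 a' b = true
    let S := if N1.Nonempty then N1 else N2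
    (S, p.2 ∪ S)

/-- The level set `S_{G,a,k}`. -/
def level {n : ℕ} (R1 R2 : Fin n → Fin n → Bool) (a : Fin n) (k : ℕ) : Finset (Fin n) :=
  (levelAux R1 R2 a k).1

/-- The union `S_{G,a,0} ∪ ⋯ ∪ S_{G,a,k}`. -/
def levelUnion {n : ℕ} (R1 R2 : Fin n → Fin n → Bool) (a : Fin n) (k : ℕ) : Finset (Fin n) :=
  (levelAux R1 R2 a k).2

/-- `height(a,G)`: the first stage `k` at which the process stops, i.e. at which neither an
`R₁`-edge nor an `R₂`-edge leaves `S_k` towards the complement of `S_0 ∪ ⋯ ∪ S_k`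
(equivalently, the first `k` with `S_{k+1} = ∅`). -/
noncomputable def heightAt {n : ℕ} (R1 R2 : Fin n → Fin n → Bool) (a : Fin n) : ℕ :=
  sInf {k | level R1 R2 a (k + 1) = ∅}

/-- `height(G) = max {height(a,G) : a ∈ [n]}`. -/
noncomputable def heightG {n : ℕ} (R1 R2 : Fin n → Fin n → Bool) : ℕ :=
  Finset.univ.sup (fun a => heightAt R1 R2 a)

lemma isProbabilityMeasure_bern {p : ℝ} (hp0 : 0 ≤ p) (hp1 : p ≤ 1) :
    IsProbabilityMeasure (bern p) := by
  constructor
  simp only [bern, Measure.add_apply, Measure.smul_apply, smul_eq_mul, measure_univ, mul_one]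
  rw [← ENNReal.ofReal_add hp0 (by linarith)]
  simp

lemma integral_bern {p : ℝ} (hp0 : 0 ≤ p) (hp1 : p ≤ 1) (f : Bool → ℝ) :
    ∫ x, f x ∂(bern p) = p * f true + (1 - p) * f false := by
  have : IsProbabilityMeasure (bern p) := isProbabilityMeasure_bern hp0 hp1
  rw [integral_fintype (.of_finite)]
  simp [bern, measureReal_def, Set.indicator, ENNReal.toReal_ofReal hp0,
    ENNReal.toReal_ofReal (sub_nonneg.mpr hp1)]

/-- The set of `b` for which the coin of `(a, b)` shows `true`. -/
def outCoins {n : ℕ} (x : Fin n × Fin n → Bool) (a : Fin n) : Finset (Fin n) :=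
  Finset.univ.filter fun b => x (a, b) = true

lemma two_pow_card_outCoins {n : ℕ} (x : Fin n × Fin n → Bool) (a : Fin n) :
    (2 : ℝ) ^ (outCoins x a).card =
      ∏ q : Fin n × Fin n, if q.1 = a ∧ x q = true then (2 : ℝ) else 1 := by
  rw [Fintype.prod_prod_type, Finset.prod_eq_single a]
  · simp [outCoins, Finset.prod_ite]
  · intro c _ hc
    simp [hc]
  · simp

lemma integral_two_pow_card_outCoins {n : ℕ} {p : ℝ} (hp0 : 0 ≤ p) (hp1 : p ≤ 1) (a : Fin n) :
    ∫ x, (2 : ℝ) ^ (outCoins x a).card ∂(Measure.pi fun _ : Fin n × Fin n => bern p) =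
      (1 + p) ^ n := by
  simp_rw [two_pow_card_outCoins]
  rw [integral_fintype_prod_eq_prod
    (f := fun (q : Fin n × Fin n) (y : Bool) => if q.1 = a ∧ y = true then (2 : ℝ) else 1)]
  simp_rw [integral_bern hp0 hp1]
  rw [Fintype.prod_prod_type, Finset.prod_eq_single a]
  · simp only [and_self, if_true, Bool.false_eq_true, and_false, if_false, Finset.prod_const,
      Finset.card_univ, Fintype.card_fin]
    ring
  · intro c _ hc
    simp [hc]
  · simp

/-- Chernoff bound for the number of successes among the `n` coins at a vertex. -/
lemma measureReal_card_outCoins_gt_le {n : ℕ} {p t : ℝ} (hp0 : 0 ≤ p) (hp1 : p ≤ 1)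
    (a : Fin n) :
    (Measure.pi fun _ : Fin n × Fin n => bern p).real {x | t < ((outCoins x a).card : ℝ)} ≤
      Real.exp (n * p - t * Real.log 2) := by
  have : IsProbabilityMeasure (bern p) := isProbabilityMeasure_bern hp0 hp1
  set μ := Measure.pi fun _ : Fin n × Fin n => bern p
  have hmarkov := mul_meas_ge_le_integral_of_nonneg (μ := μ)
    (f := fun x => (2 : ℝ) ^ (outCoins x a).card)
    (Filter.Eventually.of_forall fun x => by positivity) (.of_finite)
    (Real.exp (t * Real.log 2))
  rw [integral_two_pow_card_outCoins hp0 hp1 a] at hmarkov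
  have hsub : μ.real {x | t < ((outCoins x a).card : ℝ)} ≤
      μ.real {x | Real.exp (t * Real.log 2) ≤ (2 : ℝ) ^ (outCoins x a).card} := by
    refine measureReal_mono fun x hx => ?_
    simp only [Set.mem_ofPred_eq] at hx ⊢
    rw [← Real.rpow_natCast, Real.rpow_def_of_pos two_pos, Real.exp_le_exp, mul_comm]
    exact mul_le_mul_of_nonneg_left hx.le (Real.log_nonneg one_le_two)
  have hpow : (1 + p) ^ n ≤ Real.exp (n * p) := by
    rw [Real.exp_nat_mul]
    gcongr
    linarith [Real.add_one_le_exp p]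
  rw [Real.exp_sub, le_div_iff₀' (Real.exp_pos _)]
  exact (mul_le_mul_of_nonneg_left hsub (Real.exp_pos _).le).trans (hmarkov.trans hpow)

lemma card_level_succ_le {n : ℕ} (ω : Omega n) (a : Fin n) (m : ℕ) {t : ℝ}
    (ht : ∀ c, ((outCoins ω.2 c).card : ℝ) ≤ t)
    (hone : ¬ ∃ a' ∈ level (Rone ω) (Rtwo ω) a m, ∃ b : Fin n,
      b ∉ levelUnion (Rone ω) (Rtwo ω) a m ∧ Rone ω a' b = true) :
    ((level (Rone ω) (Rtwo ω) a (m + 1)).card : ℝ) ≤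
      (level (Rone ω) (Rtwo ω) a m).card * t := by
  have hsub : level (Rone ω) (Rtwo ω) a (m + 1) ⊆
      (level (Rone ω) (Rtwo ω) a m).biUnion (outCoins ω.2) := by
    intro b hb
    simp only [level, levelUnion] at hone hb ⊢
    rw [levelAux] at hb
    simp only at hb
    rw [if_neg] at hb
    · simp only [Finset.mem_filter, Finset.mem_univ, true_and] at hb
      obtain ⟨-, c, hc, hcb⟩ := hb
      simp only [Finset.mem_biUnion, outCoins, Finset.mem_filter, Finset.mem_univ, true_and]
      refine ⟨c, hc, ?_⟩
      unfold Rtwo at hcb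
      split_ifs at hcb
      exact hcb
    · rintro ⟨d, hd⟩
      simp only [Finset.mem_filter, Finset.mem_univ, true_and] at hd
      obtain ⟨hd, c, hc, hcd⟩ := hd
      exact hone ⟨c, hc, d, hd, hcd⟩
  calc ((level (Rone ω) (Rtwo ω) a (m + 1)).card : ℝ)
      ≤ ∑ c ∈ level (Rone ω) (Rtwo ω) a m, ((outCoins ω.2 c).card : ℝ) := by
        exact_mod_cast (Finset.card_le_card hsub).trans Finset.card_biUnion_le
    _ ≤ ∑ _c ∈ level (Rone ω) (Rtwo ω) a m, t := Finset.sum_le_sum fun c _ => ht c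
    _ = _ := by simp

lemma tendsto_mul_exp_neg_mul_rpow {α c : ℝ} (hα : 0 < α) (hc : 0 < c) :
    Filter.Tendsto (fun n : ℕ => (n : ℝ) * Real.exp (-c * (n : ℝ) ^ α)) Filter.atTop (nhds 0) := by
  have h := ((tendsto_rpow_mul_exp_neg_mul_atTop_nhds_zero α⁻¹ c hc).comp
    (tendsto_rpow_atTop hα)).comp tendsto_natCast_atTop_atTop
  refine h.congr fun n => ?_
  simp only [Function.comp]
  rw [Real.rpow_rpow_inv n.cast_nonneg hα.ne']

lemma natCast_rpow_neg_le_one {n : ℕ} (hn : 1 ≤ n) {s : ℝ} (hs : 0 ≤ s) :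
    (n : ℝ) ^ (-s) ≤ 1 :=
  Real.rpow_le_one_of_one_le_of_nonpos (by exact_mod_cast hn) (by linarith)

lemma isProbabilityMeasure_digraphMeasure {α₁ α₂ : ℝ} (h1 : 0 ≤ 1 + α₁) (h2 : 0 ≤ 1 - α₂)
    {n : ℕ} (hn : 1 ≤ n) : IsProbabilityMeasure (digraphMeasure α₁ α₂ n) := by
  have := isProbabilityMeasure_bern (Real.rpow_nonneg n.cast_nonneg _)
    (natCast_rpow_neg_le_one hn h1)
  have := isProbabilityMeasure_bern (Real.rpow_nonneg n.cast_nonneg _)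
    (natCast_rpow_neg_le_one hn h2)
  unfold digraphMeasure
  infer_instance

lemma digraphMeasure_real_exists_card_outCoins_gt_le {α₁ α₂ : ℝ} (h1 : 0 ≤ 1 + α₁)
    (h2 : 0 ≤ 1 - α₂) {n : ℕ} (hn : 1 ≤ n) :
    (digraphMeasure α₁ α₂ n).real
        {ω | ∃ a, 2 * (n : ℝ) ^ α₂ < ((outCoins ω.2 a).card : ℝ)} ≤
      n * Real.exp (-(2 * Real.log 2 - 1) * (n : ℝ) ^ α₂) := by
  have hp0 : 0 ≤ (n : ℝ) ^ (-(1 - α₂)) := Real.rpow_nonneg n.cast_nonneg _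
  have hp1 := natCast_rpow_neg_le_one hn h2
  have := isProbabilityMeasure_bern (Real.rpow_nonneg n.cast_nonneg _)
    (natCast_rpow_neg_le_one hn h1)
  have := isProbabilityMeasure_bern hp0 hp1
  have hn0 : (0 : ℝ) < n := by exact_mod_cast hn
  have hmean : (n : ℝ) * (n : ℝ) ^ (-(1 - α₂)) = (n : ℝ) ^ α₂ := by
    nth_rewrite 1 [← Real.rpow_one (n : ℝ)]
    rw [← Real.rpow_add hn0]
    congr 1
    ring
  have hset : {ω : Omega n | ∃ a, 2 * (n : ℝ) ^ α₂ < ((outCoins ω.2 a).card : ℝ)} =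
      Set.univ ×ˢ ⋃ a, {x | 2 * (n : ℝ) ^ α₂ < ((outCoins x a).card : ℝ)} := by
    ext ω
    simp
  rw [hset, digraphMeasure, measureReal_prod_prod, probReal_univ, one_mul]
  refine (measureReal_iUnion_fintype_le _).trans ?_
  refine (Finset.sum_le_sum fun a _ => measureReal_card_outCoins_gt_le hp0 hp1 a).trans ?_
  rw [hmean]
  simp only [Finset.sum_const, Finset.card_univ, Fintype.card_fin, nsmul_eq_mul]
  apply le_of_eq
  congr 2
  ring

/-- With high probability, in `G_{n,ᾱ}`: for every vertex `a` and every stage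
`m < height(a,G)`, if `S_{G,a,m+1}` is defined via `ι = 2` (no `R₁`-edge but some `R₂`-edge
leads from `S_{G,a,m}` outside `S_{G,a,0} ∪ ⋯ ∪ S_{G,a,m}`), then
`|S_{G,a,m+1}| ≤ 2 · |S_{G,a,m}| · n^{α₂}`. -/
theorem statement6 (α₁ α₂ : ℝ) (h0 : 0 < α₁) (h12 : α₁ < α₂) (h2 : α₂ < 1/4) :
    Filter.Tendsto
      (fun n : ℕ => digraphMeasure α₁ α₂ n
        {ω : Omega n | ∀ a : Fin n, ∀ m < heightAt (Rone ω) (Rtwo ω) a,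
          (¬ ∃ a' ∈ level (Rone ω) (Rtwo ω) a m, ∃ b : Fin n,
              b ∉ levelUnion (Rone ω) (Rtwo ω) a m ∧ Rone ω a' b = true) →
          (∃ a' ∈ level (Rone ω) (Rtwo ω) a m, ∃ b : Fin n,
              b ∉ levelUnion (Rone ω) (Rtwo ω) a m ∧ Rtwo ω a' b = true) →
          ((level (Rone ω) (Rtwo ω) a (m + 1)).card : ℝ)
            ≤ 2 * ((level (Rone ω) (Rtwo ω) a m).card : ℝ) * (n : ℝ) ^ α₂})
      Filter.atTop (nhds 1) := by
  have hc : 0 < 2 * Real.log 2 - 1 := by linarith [Real.log_two_gt_d9]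
  have hlow : Filter.Tendsto (fun n : ℕ => ENNReal.ofReal
      (1 - n * Real.exp (-(2 * Real.log 2 - 1) * (n : ℝ) ^ α₂))) Filter.atTop (nhds 1) := by
    have h := (tendsto_mul_exp_neg_mul_rpow (h0.trans h12) hc).const_sub 1
    simpa using ENNReal.tendsto_ofReal h
  refine tendsto_of_tendsto_of_tendsto_of_le_of_le' hlow tendsto_const_nhds ?_ ?_
  · filter_upwards [Filter.eventually_ge_atTop 1] with n hn
    have := isProbabilityMeasure_digraphMeasure (α₁ := α₁) (α₂ := α₂) (by linarith)
      (by linarith) hn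
    have hbad := digraphMeasure_real_exists_card_outCoins_gt_le (α₁ := α₁) (α₂ := α₂)
      (by linarith) (by linarith) hn
    set B := {ω : Omega n | ∃ a, 2 * (n : ℝ) ^ α₂ < ((outCoins ω.2 a).card : ℝ)}
    have hcompl : (digraphMeasure α₁ α₂ n).real Bᶜ = 1 - (digraphMeasure α₁ α₂ n).real B :=
      probReal_compl_eq_one_sub B.toFinite.measurableSet
    calc _ ≤ ENNReal.ofReal ((digraphMeasure α₁ α₂ n).real Bᶜ) :=
          ENNReal.ofReal_le_ofReal (by linarith)
      _ = digraphMeasure α₁ α₂ n Bᶜ := ofReal_measureReal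
      _ ≤ _ := by
          refine measure_mono fun ω hω => ?_
          intro a m _ hone _
          have ht : ∀ c, ((outCoins ω.2 c).card : ℝ) ≤ 2 * (n : ℝ) ^ α₂ := fun c =>
            not_lt.mp fun h => hω ⟨c, h⟩
          linarith [card_level_succ_le ω a m ht hone]
  · filter_upwards [Filter.eventually_ge_atTop 1] with n hn
    have := isProbabilityMeasure_digraphMeasure (α₁ := α₁) (α₂ := α₂) (by linarith)
      (by linarith) hn
    exact prob_le_one
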